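/- The functional J_Ψ is infinitely differentiable (of class C^∞) on the open set L^H_Γ of the finite-dimensional real vector space Range Γ. -/

import Mathlib

open Matrix MeasureTheory
open scoped ComplexOrder

/-- Entrywise integral over the unit circle, `∫_{-π}^{π} F(e^{jθ}) dθ/2π`. -/
noncomputable def circleIntM {n m : ℕ} (F : ℝ → Matrix (Fin n) (Fin m) ℂ) :
    Matrix (Fin n) (Fin m) ℂ :=
  Matrix.of fun i j => (2 * (Real.pi : ℂ))⁻¹ * ∫ θ in (-Real.pi)..Real.pi, F θ i j

/-- The transfer function `G(z) = (zI - A)⁻¹ B` evaluated at `z = e^{jθ}`. -/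
noncomputable def Gfun {n m : ℕ} (A : Matrix (Fin n) (Fin n) ℂ)
    (B : Matrix (Fin n) (Fin m) ℂ) (θ : ℝ) : Matrix (Fin n) (Fin m) ℂ :=
  (Complex.exp (θ * Complex.I) • (1 : Matrix (Fin n) (Fin n) ℂ) - A)⁻¹ * B

/-- The pair `(A, B)` is reachable: the controllability matrix
`[B, AB, ..., A^{n-1}B]` has rank `n`. -/
noncomputable def IsReachable {n m : ℕ} (A : Matrix (Fin n) (Fin n) ℂ)
    (B : Matrix (Fin n) (Fin m) ℂ) : Prop :=
  (Matrix.of fun (i : Fin n) (p : Fin n × Fin m) => (A ^ (p.1 : ℕ) * B) i p.2).rank = n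

/-- `Q_Λ(e^{jθ}) = I + G(e^{jθ})* Λ G(e^{jθ})`. -/
noncomputable def Qfun {n m : ℕ} (A : Matrix (Fin n) (Fin n) ℂ)
    (B : Matrix (Fin n) (Fin m) ℂ) (Λ : Matrix (Fin n) (Fin n) ℂ) (θ : ℝ) :
    Matrix (Fin m) (Fin m) ℂ :=
  (1 : Matrix (Fin m) (Fin m) ℂ) + (Gfun A B θ)ᴴ * Λ * Gfun A B θ

/-- The dual functional `J_Ψ(Λ) = tr ∫ Q_Λ⁻¹ Ψ + tr Λ` (a real number). -/
noncomputable def Jfun {n m : ℕ} (A : Matrix (Fin n) (Fin n) ℂ)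
    (B : Matrix (Fin n) (Fin m) ℂ) (Ψ : ℝ → Matrix (Fin m) (Fin m) ℂ)
    (Λ : Matrix (Fin n) (Fin n) ℂ) : ℝ :=
  ((circleIntM fun θ => (Qfun A B Λ θ)⁻¹ * Ψ θ).trace + Λ.trace).re

attribute [local instance] Matrix.normedAddCommGroup Matrix.normedSpace

/-- `M` belongs to `Range Γ`: it is `∫ G Φ G*` for some continuous Hermitian-matrix-valued
function `Φ` on the unit circle. -/
def InRangeGamma {n m : ℕ} (A : Matrix (Fin n) (Fin n) ℂ) (B : Matrix (Fin n) (Fin m) ℂ)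
    (M : Matrix (Fin n) (Fin n) ℂ) : Prop :=
  ∃ Φ : ℝ → Matrix (Fin m) (Fin m) ℂ,
    Continuous Φ ∧ Function.Periodic Φ (2 * Real.pi) ∧
    (∀ θ : ℝ, (Φ θ).IsHermitian) ∧
    circleIntM (fun θ => Gfun A B θ * Φ θ * (Gfun A B θ)ᴴ) = M

section MatrixSmoothness

variable {E R ι : Type*} [NormedAddCommGroup E] [NormedSpace ℝ E] [NormedCommRing R]
  [NormedAlgebra ℝ R] [Fintype ι] [DecidableEq ι] {k : WithTop ℕ∞} {M : E → Matrix ι ι R} {x : E}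

theorem contDiffAt_matrix_det (h : ∀ i j, ContDiffAt ℝ k (fun y => M y i j) x) :
    ContDiffAt ℝ k (fun y => (M y).det) x := by
  simp only [Matrix.det_apply]
  refine ContDiffAt.sum fun σ _ => ContDiffAt.const_smul _ ?_
  exact contDiffAt_prod fun i _ => h _ _

theorem contDiffAt_matrix_adjugate (h : ∀ i j, ContDiffAt ℝ k (fun y => M y i j) x) (i j : ι) :
    ContDiffAt ℝ k (fun y => (M y).adjugate i j) x := by
  simp only [Matrix.adjugate_apply]
  refine contDiffAt_matrix_det fun a b => ?_
  by_cases hab : a = j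
  · simpa [Matrix.updateRow_apply, hab] using contDiffAt_const
  · simpa [Matrix.updateRow_apply, hab] using h a b

end MatrixSmoothness

/-- Integration over `[a, b]` as a continuous linear functional on `C([a, b], ℂ)`. -/
noncomputable def intervalIntegralCLM {a b : ℝ} (hab : a ≤ b) : C(Set.Icc a b, ℂ) →L[ℝ] ℂ :=
  LinearMap.mkContinuous
    { toFun := fun f => ∫ θ in a..b, f (Set.projIcc a b hab θ)
      map_add' := fun f g => by
        have hc : ∀ f : C(Set.Icc a b, ℂ), Continuous fun θ => f (Set.projIcc a b hab θ) :=
          fun f => f.continuous.comp continuous_projIcc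
        exact intervalIntegral.integral_add ((hc f).intervalIntegrable _ _)
          ((hc g).intervalIntegrable _ _)
      map_smul' := fun c f => intervalIntegral.integral_smul c _ }
    |b - a| fun f => by
      rw [mul_comm]
      exact intervalIntegral.norm_integral_le_of_norm_le_const fun θ _ => f.norm_coe_le_norm _

theorem intervalIntegralCLM_apply {a b : ℝ} (hab : a ≤ b) (f : C(Set.Icc a b, ℂ)) {g : ℝ → ℂ}
    (hfg : ∀ θ : Set.Icc a b, f θ = g θ) : intervalIntegralCLM hab f = ∫ θ in a..b, g θ := by
  refine intervalIntegral.integral_congr fun θ hθ => ?_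
  rw [Set.uIcc_of_le hab] at hθ
  simp only [hfg, Set.projIcc_of_mem hab hθ]

theorem continuous_Gfun {n m : ℕ} (A : Matrix (Fin n) (Fin n) ℂ) (B : Matrix (Fin n) (Fin m) ℂ)
    (hA : ∀ z ∈ spectrum ℂ A, ‖z‖ < 1) : Continuous (Gfun A B) := by
  have hM : Continuous fun θ : ℝ =>
      Complex.exp (θ * Complex.I) • (1 : Matrix (Fin n) (Fin n) ℂ) - A := by fun_prop
  have hdet : ∀ θ : ℝ,
      (Complex.exp (θ * Complex.I) • (1 : Matrix (Fin n) (Fin n) ℂ) - A).det ≠ 0 := by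
    intro θ
    have hθ : Complex.exp (θ * Complex.I) ∉ spectrum ℂ A := fun h => by
      have := hA _ h
      rw [Complex.norm_exp_ofReal_mul_I] at this
      exact lt_irrefl _ this
    rw [spectrum.notMem_iff, Algebra.algebraMap_eq_smul_one, Matrix.isUnit_iff_isUnit_det] at hθ
    exact hθ.ne_zero
  unfold Gfun
  simp only [Matrix.inv_def, Ring.inverse_eq_inv']
  exact ((hM.matrix_det.inv₀ hdet).smul hM.matrix_adjugate).matrix_mul continuous_const

section Curve

variable {n m : ℕ} {A : Matrix (Fin n) (Fin n) ℂ} {B : Matrix (Fin n) (Fin m) ℂ}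

/-- The function `Q_Λ` on `[-π, π]` as a matrix with entries in `C([-π, π], ℂ)`. -/
noncomputable def Qcont (hG : Continuous (Gfun A B)) (Λ : Matrix (Fin n) (Fin n) ℂ) :
    Matrix (Fin m) (Fin m) C(Set.Icc (-Real.pi) Real.pi, ℂ) :=
  Matrix.of fun i j => (1 : Matrix (Fin m) (Fin m) C(Set.Icc (-Real.pi) Real.pi, ℂ)) i j +
    ∑ b, ∑ a, Λ a b • (⟨fun θ => star (Gfun A B θ a i) * Gfun A B θ b j, by fun_prop⟩ :
      C(Set.Icc (-Real.pi) Real.pi, ℂ))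

/-- Evaluation at `θ` as a ring homomorphism. -/
noncomputable def evalHom (θ : Set.Icc (-Real.pi) Real.pi) :
    C(Set.Icc (-Real.pi) Real.pi, ℂ) →+* ℂ :=
  (ContinuousMap.evalAlgHom ℂ ℂ θ).toRingHom

theorem map_Qcont (hG : Continuous (Gfun A B)) (Λ : Matrix (Fin n) (Fin n) ℂ)
    (θ : Set.Icc (-Real.pi) Real.pi) :
    (evalHom θ).mapMatrix (Qcont hG Λ) = Qfun A B Λ θ := by
  ext i j
  have h1 : evalHom θ ((1 : Matrix (Fin m) (Fin m) C(Set.Icc (-Real.pi) Real.pi, ℂ)) i j)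
      = (1 : Matrix (Fin m) (Fin m) ℂ) i j := by
    rw [Matrix.one_apply, Matrix.one_apply, apply_ite (evalHom θ), map_one, map_zero]
  have h2 : ∀ (c : ℂ) (f : C(Set.Icc (-Real.pi) Real.pi, ℂ)),
      evalHom θ (c • f) = c * f θ := fun c f => rfl
  simp only [Qcont, Qfun, RingHom.mapMatrix_apply, Matrix.map_apply, Matrix.of_apply, map_add,
    map_sum, h1, h2, Matrix.add_apply, Matrix.mul_apply, Matrix.conjTranspose_apply,
    Finset.sum_mul, ContinuousMap.coe_mk]
  congr 1
  refine Finset.sum_congr rfl fun b _ => Finset.sum_congr rfl fun a _ => by ring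

theorem eval_det_Qcont (hG : Continuous (Gfun A B)) (Λ : Matrix (Fin n) (Fin n) ℂ)
    (θ : Set.Icc (-Real.pi) Real.pi) : (Qcont hG Λ).det θ = (Qfun A B Λ θ).det := by
  rw [← map_Qcont hG, ← RingHom.map_det]
  rfl

theorem eval_adjugate_Qcont (hG : Continuous (Gfun A B)) (Λ : Matrix (Fin n) (Fin n) ℂ)
    (θ : Set.Icc (-Real.pi) Real.pi) (i j : Fin m) :
    (Qcont hG Λ).adjugate i j θ = (Qfun A B Λ θ).adjugate i j := by
  rw [← map_Qcont hG, ← RingHom.map_adjugate]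
  rfl

theorem contDiff_Qcont (hG : Continuous (Gfun A B)) {k : WithTop ℕ∞} (i j : Fin m) :
    ContDiff ℝ k fun Λ : Matrix (Fin n) (Fin n) ℂ => Qcont hG Λ i j := by
  refine contDiff_const.add (ContDiff.sum fun b _ => ContDiff.sum fun a _ => ?_)
  exact ContDiff.smul (contDiff_apply_apply ℝ ℂ a b) contDiff_const

/-- The entries of `Q_Λ⁻¹ Ψ` as elements of `C([-π, π], ℂ)`. -/
noncomputable def invMulEntry (hG : Continuous (Gfun A B)) {Ψ : ℝ → Matrix (Fin m) (Fin m) ℂ}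
    (hΨ : Continuous Ψ) (i j : Fin m) (Λ : Matrix (Fin n) (Fin n) ℂ) :
    C(Set.Icc (-Real.pi) Real.pi, ℂ) :=
  ∑ l, Ring.inverse (Qcont hG Λ).det * (Qcont hG Λ).adjugate i l *
    (⟨fun θ => Ψ θ l j, by fun_prop⟩ : C(Set.Icc (-Real.pi) Real.pi, ℂ))

theorem contDiffAt_invMulEntry (hG : Continuous (Gfun A B)) {Ψ : ℝ → Matrix (Fin m) (Fin m) ℂ}
    (hΨ : Continuous Ψ) {k : WithTop ℕ∞} (i j : Fin m) {Λ : Matrix (Fin n) (Fin n) ℂ}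
    (hΛ : IsUnit (Qcont hG Λ).det) : ContDiffAt ℝ k (invMulEntry hG hΨ i j) Λ := by
  have hQ := fun i j => (contDiff_Qcont hG (k := k) i j).contDiffAt (x := Λ)
  obtain ⟨u, hu⟩ := hΛ
  have hinv : ContDiffAt ℝ k (fun Λ => Ring.inverse (Qcont hG Λ).det) Λ := by
    refine ContDiffAt.comp Λ (g := Ring.inverse) ?_ (contDiffAt_matrix_det hQ)
    rw [← hu]
    exact contDiffAt_ringInverse ℝ u
  exact ContDiffAt.sum fun l _ =>
    (hinv.mul (contDiffAt_matrix_adjugate hQ i l)).mul contDiffAt_const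

theorem eval_invMulEntry (hG : Continuous (Gfun A B)) {Ψ : ℝ → Matrix (Fin m) (Fin m) ℂ}
    (hΨ : Continuous Ψ) (i j : Fin m) {Λ : Matrix (Fin n) (Fin n) ℂ}
    (hΛ : IsUnit (Qcont hG Λ).det) (θ : Set.Icc (-Real.pi) Real.pi) :
    invMulEntry hG hΨ i j Λ θ = ((Qfun A B Λ θ)⁻¹ * Ψ θ) i j := by
  have hinv : Ring.inverse (Qcont hG Λ).det θ = (Qfun A B Λ θ).det⁻¹ := by
    refine eq_inv_of_mul_eq_one_left ?_
    rw [← eval_det_Qcont hG, ← ContinuousMap.mul_apply, Ring.inverse_mul_cancel _ hΛ,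
      ContinuousMap.one_apply]
  simp only [invMulEntry, ContinuousMap.sum_apply, ContinuousMap.mul_apply, hinv,
    eval_adjugate_Qcont, ContinuousMap.coe_mk, Matrix.mul_apply, Matrix.inv_def,
    Ring.inverse_eq_inv', Matrix.smul_apply, smul_eq_mul]

theorem isUnit_det_Qcont (hG : Continuous (Gfun A B)) {Λ : Matrix (Fin n) (Fin n) ℂ}
    (hΛ : ∀ θ : ℝ, (Qfun A B Λ θ).det ≠ 0) : IsUnit (Qcont hG Λ).det := by
  rw [ContinuousMap.isUnit_iff_forall_ne_zero]
  intro θ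
  rw [eval_det_Qcont]
  exact hΛ θ

end Curve

theorem stmt10 {n m : ℕ} (A : Matrix (Fin n) (Fin n) ℂ) (B : Matrix (Fin n) (Fin m) ℂ)
    (hA : ∀ z ∈ spectrum ℂ A, ‖z‖ < 1) (hB : B.rank = m) (hAB : IsReachable A B)
    (Ψ : ℝ → Matrix (Fin m) (Fin m) ℂ) (hΨc : Continuous Ψ)
    (hΨper : Function.Periodic Ψ (2 * Real.pi)) (hΨpd : ∀ θ : ℝ, (Ψ θ).PosDef) :
    ContDiffOn ℝ (⊤ : ℕ∞) (Jfun A B Ψ)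
      {Λ : Matrix (Fin n) (Fin n) ℂ |
        InRangeGamma A B Λ ∧ ∀ θ : ℝ, (Qfun A B Λ θ).PosDef} := by
  have hG := continuous_Gfun A B hA
  rintro Λ ⟨-, hΛ⟩
  refine ContDiffAt.contDiffWithinAt ?_
  have hunit : IsUnit (Qcont hG Λ).det :=
    isUnit_det_Qcont hG fun θ => (hΛ θ).isUnit.map Matrix.detMonoidHom |>.ne_zero
  have hpi : -Real.pi ≤ Real.pi := by linarith [Real.pi_pos]
  have hnhds : ∀ᶠ L in nhds Λ, IsUnit (Qcont hG L).det :=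
    (contDiffAt_matrix_det (k := 0) fun i j =>
      (contDiff_Qcont hG i j).contDiffAt).continuousAt.eventually (Units.isOpen.mem_nhds hunit)
  have hsmooth : ContDiffAt ℝ (⊤ : ℕ∞) (fun L : Matrix (Fin n) (Fin n) ℂ =>
      Complex.reCLM ((∑ i, (2 * (Real.pi : ℂ))⁻¹ *
        intervalIntegralCLM hpi (invMulEntry hG hΨc i i L)) + ∑ i, L i i)) Λ := by
    refine Complex.reCLM.contDiff.contDiffAt.comp Λ (ContDiffAt.add ?_ ?_)
    · exact ContDiffAt.sum fun i _ => contDiffAt_const.mul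
        ((intervalIntegralCLM hpi).contDiff.contDiffAt.comp Λ
          (contDiffAt_invMulEntry hG hΨc i i hunit))
    · exact ContDiffAt.sum fun i _ => (contDiff_apply_apply ℝ ℂ i i).contDiffAt
  refine hsmooth.congr_of_eventuallyEq (hnhds.mono fun L hL => ?_)
  have hint : ∀ i, intervalIntegralCLM hpi (invMulEntry hG hΨc i i L) =
      ∫ θ in (-Real.pi)..Real.pi, ((Qfun A B L θ)⁻¹ * Ψ θ) i i := fun i =>
    intervalIntegralCLM_apply hpi _ (eval_invMulEntry hG hΨc i i hL)
  simp only [hint]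
  rfl
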